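/- arXiv:1202.6048 — 3 statements merged into one kernel-verified Lean document; each statement's English description precedes it below -/
import Mathlib

section
/- Let a, b, c, d be complex numbers with ab = cd. Then for every t ∈ (−π, π], S(H_t(a,b)) = S(H_t(c,d)); that is, a complex number λ is an eigenvalue of H_t(a,b) if and only if it is an eigenvalue of H_t(c,d). -/
open Real Complex Set

/-- The Mathieu potential `a·exp(−2πi x) + b·exp(2πi x)`. -/
noncomputable def mathieuPot (a b : ℂ) (x : ℝ) : ℂ :=
  a * Complex.exp (-(2 * Real.pi * Complex.I) * (x : ℂ)) +
    b * Complex.exp (2 * Real.pi * Complex.I * (x : ℂ))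

/-- `λ` is an eigenvalue of the operator `H_t(a,b)`: there is a twice continuously
differentiable function `y`, not identically zero on `[0,1]`, satisfying
`−y'' + (a e^{−2πix} + b e^{2πix}) y = λ y` on `[0,1]` with the `t`-quasiperiodic
boundary conditions. -/
def IsEigenvalueH (a b : ℂ) (t : ℝ) (lam : ℂ) : Prop :=
  ∃ y : ℝ → ℂ, ContDiff ℝ 2 y ∧
    (¬ ∀ x ∈ Set.Icc (0:ℝ) 1, y x = 0) ∧
    (∀ x ∈ Set.Icc (0:ℝ) 1,
      -(deriv (deriv y) x) + mathieuPot a b x * y x = lam * y x) ∧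
    y 1 = Complex.exp (Complex.I * t) * y 0 ∧
    deriv y 1 = Complex.exp (Complex.I * t) * deriv y 0

/-- The sequence `μ` tends to infinity in norm at both ends of `ℤ`. -/
def NormDiverges (μ : ℤ → ℂ) : Prop :=
  ∀ K : ℝ, ∃ N : ℕ, ∀ n : ℤ, N ≤ n.natAbs → K ≤ ‖μ n‖

/-- The three-term recurrence `μ n * c n + a * c (n + 1) + b * c (n - 1) = 0` on `ℤ`. -/
def IsRecurrenceSol (μ : ℤ → ℂ) (a b : ℂ) (c : ℤ → ℂ) : Prop :=
  ∀ n, μ n * c n + a * c (n + 1) + b * c (n - 1) = 0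

/-- The recurrence with coefficients `μ`, `a`, `b` has a nonzero bounded solution. -/
def HasBoundedSol (μ : ℤ → ℂ) (a b : ℂ) : Prop :=
  ∃ c : ℤ → ℂ, c ≠ 0 ∧ (∃ C, ∀ n, ‖c n‖ ≤ C) ∧ IsRecurrenceSol μ a b c

/-- Bounded solutions of the recurrence decay faster than any geometric sequence. -/
theorem IsRecurrenceSol.exists_decay {μ : ℤ → ℂ} (hμ : NormDiverges μ) {a b : ℂ} {c : ℤ → ℂ}
    (hc : ∃ C, ∀ n, ‖c n‖ ≤ C) (hrec : IsRecurrenceSol μ a b c) {R : ℝ} (hR : 1 ≤ R) :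
    ∃ C, 0 ≤ C ∧ ∀ n : ℤ, ‖c n‖ * R ^ n.natAbs ≤ C := by
  obtain ⟨C, hC⟩ := hc
  have hC0 : 0 ≤ C := (norm_nonneg _).trans (hC 0)
  obtain ⟨N, hN⟩ := hμ ((‖a‖ + ‖b‖) * R + 1)
  have hR0 : 0 < R := by linarith
  have key : ∀ k : ℕ, ∀ n : ℤ, N + k ≤ n.natAbs → ‖c n‖ * R ^ k ≤ C := by
    intro k
    induction k with
    | zero => intro n _; simpa using hC n
    | succ k ih =>
      intro n hn
      have h1 := ih (n + 1) (by omega)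
      have h2 := ih (n - 1) (by omega)
      have h3 := hN n (by omega)
      have h4 : ‖μ n‖ * ‖c n‖ ≤ ‖a‖ * ‖c (n + 1)‖ + ‖b‖ * ‖c (n - 1)‖ := by
        have : μ n * c n = -(a * c (n + 1) + b * c (n - 1)) := by
          linear_combination hrec n
        rw [← norm_mul, this, norm_neg]
        exact (norm_add_le _ _).trans (by rw [norm_mul, norm_mul])
      have hRk : 0 < R ^ k := by positivity
      have h5 : ‖μ n‖ * (‖c n‖ * R ^ k) ≤ (‖a‖ + ‖b‖) * C := by
        calc ‖μ n‖ * (‖c n‖ * R ^ k) = (‖μ n‖ * ‖c n‖) * R ^ k := by ring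
          _ ≤ (‖a‖ * ‖c (n + 1)‖ + ‖b‖ * ‖c (n - 1)‖) * R ^ k := by gcongr
          _ = ‖a‖ * (‖c (n + 1)‖ * R ^ k) + ‖b‖ * (‖c (n - 1)‖ * R ^ k) := by ring
          _ ≤ ‖a‖ * C + ‖b‖ * C := by gcongr
          _ = _ := by ring
      have h6 : ((‖a‖ + ‖b‖) * R + 1) * (‖c n‖ * R ^ k) ≤ (‖a‖ + ‖b‖) * C :=
        (mul_le_mul_of_nonneg_right h3 (by positivity)).trans h5
      by_contra! h7
      have h8 : ‖c n‖ * R ^ (k + 1) = R * (‖c n‖ * R ^ k) := by ring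
      rw [h8] at h7
      have hx : 0 < ‖c n‖ * R ^ k := by
        by_contra! h9
        nlinarith
      have h10 : 0 ≤ ‖a‖ + ‖b‖ := by positivity
      nlinarith [mul_le_mul_of_nonneg_left h7.le h10]
  refine ⟨C * R ^ N, by positivity, fun n => ?_⟩
  rcases le_total N n.natAbs with h | h
  · have := key (n.natAbs - N) n (by omega)
    calc ‖c n‖ * R ^ n.natAbs = (‖c n‖ * R ^ (n.natAbs - N)) * R ^ N := by
          rw [mul_assoc, ← pow_add, Nat.sub_add_cancel h]
      _ ≤ C * R ^ N := by gcongr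
  · exact mul_le_mul (hC n) (pow_le_pow_right₀ hR h) (by positivity) hC0

theorem norm_zpow_le_pow_natAbs {s : ℂ} (hs : s ≠ 0) (n : ℤ) :
    ‖s ^ n‖ ≤ (1 + ‖s‖ + ‖s‖⁻¹) ^ n.natAbs := by
  have h0 : 0 ≤ ‖s‖ := norm_nonneg s
  have h1 : 0 ≤ ‖s‖⁻¹ := by positivity
  rw [norm_zpow]
  rcases Int.natAbs_eq n with h | h
  · conv_lhs => rw [h]
    rw [zpow_natCast]
    exact pow_le_pow_left₀ h0 (by linarith) _
  · conv_lhs => rw [h]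
    rw [zpow_neg, zpow_natCast, ← inv_pow]
    exact pow_le_pow_left₀ h1 (by linarith) _

theorem HasBoundedSol.rescale {μ : ℤ → ℂ} (hμ : NormDiverges μ) {a b s : ℂ} (hs : s ≠ 0)
    (h : HasBoundedSol μ a b) : HasBoundedSol μ (a * s⁻¹) (b * s) := by
  obtain ⟨c, hc0, hcb, hrec⟩ := h
  obtain ⟨C, -, hC⟩ := hrec.exists_decay hμ hcb (R := 1 + ‖s‖ + ‖s‖⁻¹)
    (by have := norm_nonneg s; have : 0 ≤ ‖s‖⁻¹ := by positivity
        linarith)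
  refine ⟨fun n => s ^ n * c n, fun h0 => hc0 ?_, ⟨C, fun n => ?_⟩, fun n => ?_⟩
  · funext n
    simpa [zpow_ne_zero n hs] using congrFun h0 n
  · rw [norm_mul, mul_comm]
    exact (mul_le_mul_of_nonneg_left (norm_zpow_le_pow_natAbs hs n) (norm_nonneg _)).trans (hC n)
  · simp only [zpow_add_one₀ hs, zpow_sub_one₀ hs]
    field_simp
    linear_combination s ^ n * hrec n

theorem HasBoundedSol.reflect {μ : ℤ → ℂ} {a b : ℂ} (h : HasBoundedSol μ a b) :
    HasBoundedSol (fun n => μ (-n)) b a := by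
  obtain ⟨c, hc0, ⟨C, hC⟩, hrec⟩ := h
  refine ⟨fun n => c (-n), fun h0 => hc0 ?_, ⟨C, fun n => hC _⟩, fun n => ?_⟩
  · funext n
    simpa using congrFun h0 (-n)
  · have := hrec (-n)
    rw [show -n + 1 = -(n - 1) by ring, show -n - 1 = -(n + 1) by ring] at this
    linear_combination this

theorem NormDiverges.reflect {μ : ℤ → ℂ} (hμ : NormDiverges μ) :
    NormDiverges fun n => μ (-n) := fun K => by
  obtain ⟨N, hN⟩ := hμ K
  exact ⟨N, fun n hn => hN _ (by simpa using hn)⟩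

theorem exists_eq_zero_of_hasBoundedSol_right_zero {μ : ℤ → ℂ} (hμ : NormDiverges μ) {a : ℂ}
    (h : HasBoundedSol μ a 0) : ∃ n, μ n = 0 := by
  by_contra! hne
  obtain ⟨c, hc0, ⟨C, hC⟩, hrec⟩ := h
  obtain ⟨N, hN⟩ := hμ (2 * ‖a‖ + 1)
  have step : ∀ n : ℤ, (N : ℤ) ≤ n → 2 * ‖c n‖ ≤ ‖c (n + 1)‖ := by
    intro n hn
    have h1 := hN n (by omega)
    have h2 : ‖μ n‖ * ‖c n‖ = ‖a‖ * ‖c (n + 1)‖ := by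
      rw [← norm_mul, ← norm_mul, ← norm_neg]
      congr 1
      linear_combination -hrec n
    have h3 := mul_le_mul_of_nonneg_right h1 (norm_nonneg (c n))
    rcases eq_or_ne a 0 with rfl | ha
    · have : ‖c n‖ = 0 := by
        simpa [hne n] using h2
      rw [this]; simp
    · have ha' : 0 < ‖a‖ := norm_pos_iff.mpr ha
      have h4 := norm_nonneg (c n)
      by_contra! h5
      nlinarith [mul_lt_mul_of_pos_left h5 ha']
  have tail : ∀ n : ℤ, (N : ℤ) ≤ n → c n = 0 := by
    intro n hn
    have h1 : ∀ k : ℕ, 2 ^ k * ‖c n‖ ≤ C := by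
      have : ∀ k : ℕ, 2 ^ k * ‖c n‖ ≤ ‖c (n + k)‖ := by
        intro k
        induction k with
        | zero => simp
        | succ k ih =>
          have := step (n + k) (by omega)
          push_cast
          rw [← add_assoc, pow_succ]
          linarith
      exact fun k => (this k).trans (hC _)
    by_contra h0
    have hpos : 0 < ‖c n‖ := norm_pos_iff.mpr h0
    obtain ⟨k, hk⟩ := pow_unbounded_of_one_lt (C / ‖c n‖) (one_lt_two (α := ℝ))
    rw [div_lt_iff₀ hpos] at hk
    exact absurd (h1 k) (not_le.mpr hk)
  have down : ∀ k : ℕ, c (N - k) = 0 := by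
    intro k
    induction k with
    | zero => exact tail _ (by simp)
    | succ k ih =>
      have h1 := hrec (N - (k + 1 : ℕ))
      rw [show (N : ℤ) - (k + 1 : ℕ) + 1 = N - k by push_cast; ring, ih] at h1
      simpa [hne] using h1
  refine hc0 (funext fun n => ?_)
  rcases le_total (N : ℤ) n with h | h
  · exact tail n h
  · have := down (N - n).toNat
    rwa [Int.toNat_of_nonneg (by omega), sub_sub_cancel] at this

theorem hasBoundedSol_right_zero_of_exists_eq_zero {μ : ℤ → ℂ} (hμ : NormDiverges μ) (a : ℂ)
    (h : ∃ n, μ n = 0) : HasBoundedSol μ a 0 := by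
  obtain ⟨m, hm, hmin⟩ : ∃ m, μ m = 0 ∧ ∀ n, μ n = 0 → m ≤ n := by
    refine Int.exists_least_of_bdd ?_ h
    obtain ⟨N, hN⟩ := hμ 1
    refine ⟨-N, fun n hn => ?_⟩
    by_contra! hlt
    have := hN n (by omega)
    simp [hn] at this
    linarith
  let f : ℕ → ℂ := fun k => Nat.rec 1 (fun k z => -a / μ (m - k - 1) * z) k
  have hf : ∀ k, f (k + 1) = -a / μ (m - k - 1) * f k := fun k => rfl
  have hfb : ∃ C, ∀ k, ‖f k‖ ≤ C := by
    obtain ⟨N, hN⟩ := hμ (‖a‖ + 1)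
    have hanti : ∀ j, ‖f (N + m.natAbs + j)‖ ≤ ‖f (N + m.natAbs)‖ := by
      intro j
      induction j with
      | zero => simp
      | succ j ih =>
        refine le_trans ?_ ih
        rw [← add_assoc, hf, norm_mul, norm_div, norm_neg]
        refine mul_le_of_le_one_left (norm_nonneg _) ?_
        have := hN (m - (N + m.natAbs + j : ℕ) - 1) (by omega)
        have ha := norm_nonneg a
        rw [div_le_one (by linarith)]
        linarith
    refine ⟨∑ k ∈ Finset.range (N + m.natAbs + 1), ‖f k‖, fun k => ?_⟩
    have hle : ∀ i ≤ N + m.natAbs, ‖f i‖ ≤ ∑ k ∈ Finset.range (N + m.natAbs + 1), ‖f k‖ :=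
      fun i hi => Finset.single_le_sum (f := fun k => ‖f k‖) (fun _ _ => norm_nonneg _)
        (Finset.mem_range.mpr (by omega))
    rcases le_total k (N + m.natAbs) with hk | hk
    · exact hle k hk
    · obtain ⟨j, rfl⟩ := Nat.exists_eq_add_of_le hk
      exact (hanti j).trans (hle _ le_rfl)
  obtain ⟨C, hC⟩ := hfb
  have hC0 : 0 ≤ C := (norm_nonneg _).trans (hC 0)
  refine ⟨fun n => if n ≤ m then f (m - n).toNat else 0, fun h0 => ?_, ⟨C, fun n => ?_⟩,
    fun n => ?_⟩
  · simpa [f] using congrFun h0 m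
  · dsimp only
    split_ifs
    · exact hC _
    · simpa using hC0
  · rcases lt_trichotomy n m with hn | rfl | hn
    · obtain ⟨k, hk⟩ : ∃ k : ℕ, n = m - k - 1 := ⟨(m - n - 1).toNat, by omega⟩
      have hne : μ n ≠ 0 := fun h0 => absurd (hmin n h0) (not_le.mpr hn)
      have e1 : (m - n).toNat = k + 1 := by omega
      have e2 : (m - (n + 1)).toNat = k := by omega
      simp only [hn.le, show n + 1 ≤ m by omega, if_true, e1, e2, hf, ← hk]
      field_simp
      ring
    · simp [hm]
    · simp [show ¬ n ≤ m by omega, show ¬ n + 1 ≤ m by omega]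

theorem hasBoundedSol_iff_of_mul_eq_zero {μ : ℤ → ℂ} (hμ : NormDiverges μ) {a b : ℂ}
    (h : a * b = 0) : HasBoundedSol μ a b ↔ ∃ n, μ n = 0 := by
  rcases mul_eq_zero.mp h with rfl | rfl
  · constructor
    · intro hs
      obtain ⟨n, hn⟩ := exists_eq_zero_of_hasBoundedSol_right_zero hμ.reflect hs.reflect
      exact ⟨-n, hn⟩
    · rintro ⟨n, hn⟩
      simpa using (hasBoundedSol_right_zero_of_exists_eq_zero hμ.reflect b
        ⟨-n, by simpa using hn⟩).reflect
  · exact ⟨exists_eq_zero_of_hasBoundedSol_right_zero hμ,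
      hasBoundedSol_right_zero_of_exists_eq_zero hμ a⟩

/-- Existence of a nonzero bounded solution depends on `a`, `b` only through `a * b`. -/
theorem hasBoundedSol_iff_of_mul_eq_mul {μ : ℤ → ℂ} (hμ : NormDiverges μ) {a b c d : ℂ}
    (h : a * b = c * d) : HasBoundedSol μ a b ↔ HasBoundedSol μ c d := by
  rcases eq_or_ne (a * b) 0 with h0 | h0
  · rw [hasBoundedSol_iff_of_mul_eq_zero hμ h0, hasBoundedSol_iff_of_mul_eq_zero hμ (h ▸ h0)]
  · obtain ⟨ha, -⟩ := mul_ne_zero_iff.mp h0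
    obtain ⟨hc, -⟩ := mul_ne_zero_iff.mp (h ▸ h0)
    constructor
    · intro hs
      convert hs.rescale hμ (div_ne_zero ha hc) using 1
      · field_simp
      · field_simp
        linear_combination -h
    · intro hs
      convert hs.rescale hμ (div_ne_zero hc ha) using 1
      · field_simp
      · field_simp
        linear_combination h

/-- The exponential `exp(i(2πn + t)x)`. -/
noncomputable def quasiExp (t : ℝ) (n : ℤ) (x : ℝ) : ℂ :=
  Complex.exp (Complex.I * (2 * Real.pi * n + t) * x)

theorem hasDerivAt_quasiExp (t : ℝ) (n : ℤ) (x : ℝ) :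
    HasDerivAt (quasiExp t n) (Complex.I * (2 * Real.pi * n + t) * quasiExp t n x) x := by
  have h : HasDerivAt (fun x : ℝ => Complex.I * (2 * Real.pi * n + t) * (x : ℂ))
      (Complex.I * (2 * Real.pi * n + t)) x := by
    simpa using (Complex.ofRealCLM.hasDerivAt (x := x)).const_mul
      (Complex.I * (2 * Real.pi * n + t))
  rw [mul_comm]
  exact h.cexp

theorem continuous_quasiExp (t : ℝ) (n : ℤ) : Continuous (quasiExp t n) := by
  unfold quasiExp; fun_prop

theorem norm_quasiExp (t : ℝ) (n : ℤ) (x : ℝ) : ‖quasiExp t n x‖ = 1 := by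
  rw [quasiExp, show Complex.I * (2 * Real.pi * n + t) * x =
    (((2 * Real.pi * n + t) * x : ℝ) : ℂ) * Complex.I by push_cast; ring]
  exact Complex.norm_exp_ofReal_mul_I _

theorem quasiExp_zero (t : ℝ) (n : ℤ) : quasiExp t n 0 = 1 := by simp [quasiExp]

theorem quasiExp_one (t : ℝ) (n : ℤ) : quasiExp t n 1 = Complex.exp (Complex.I * t) := by
  rw [quasiExp, show Complex.I * (2 * Real.pi * n + t) * (1 : ℝ) =
    Complex.I * t + n * (2 * Real.pi * Complex.I) by push_cast; ring]
  exact Complex.exp_periodic.int_mul n _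

theorem quasiExp_mul (s t : ℝ) (m n : ℤ) (x : ℝ) :
    quasiExp s m x * quasiExp t n x = quasiExp (s + t) (m + n) x := by
  simp only [quasiExp, ← Complex.exp_add]
  congr 1
  push_cast
  ring

theorem mathieuPot_eq (a b : ℂ) (x : ℝ) :
    mathieuPot a b x = a * quasiExp 0 (-1) x + b * quasiExp 0 1 x := by
  simp only [mathieuPot, quasiExp]
  congr 3 <;> · push_cast; ring_nf

theorem integral_quasiExp_zero (n : ℤ) :
    ∫ x in (0 : ℝ)..1, quasiExp 0 n x = if n = 0 then 1 else 0 := by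
  split_ifs with h
  · simp [h, quasiExp]
  · have hc : Complex.I * (2 * Real.pi * n + (0 : ℝ)) ≠ 0 := by
      simp [h, Real.pi_ne_zero]
    have h1 := quasiExp_one 0 n
    have h0 := quasiExp_zero 0 n
    unfold quasiExp at *
    rw [integral_exp_mul_complex hc, h1, h0]
    simp

/-- The Fourier multiplier of `-d²/dx² - lam` on `t`-quasiperiodic functions. -/
noncomputable def hillSymbol (t : ℝ) (lam : ℂ) (n : ℤ) : ℂ :=
  (2 * Real.pi * n + t) ^ 2 - lam

theorem normDiverges_hillSymbol (t : ℝ) (lam : ℂ) : NormDiverges (hillSymbol t lam) := by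
  intro K
  obtain ⟨N, hN⟩ := exists_nat_ge (|t| + (1 + |K| + ‖lam‖))
  refine ⟨N, fun n hn => ?_⟩
  have h1 : ‖((2 * Real.pi * n + t : ℝ) : ℂ) ^ 2‖ ≤ ‖hillSymbol t lam n‖ + ‖lam‖ := by
    refine le_trans (le_of_eq ?_) (norm_add_le _ _)
    congr 1
    simp only [hillSymbol]; push_cast; ring
  rw [norm_pow, Complex.norm_real, Real.norm_eq_abs] at h1
  have h2 : (N : ℝ) ≤ |(n : ℝ)| := by
    rw [← Int.cast_abs, Int.abs_eq_natAbs]; exact_mod_cast hn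
  have h3 : |(n : ℝ)| ≤ |2 * Real.pi * n| := by
    rw [abs_mul, abs_of_pos (by positivity : 0 < 2 * Real.pi)]
    nlinarith [Real.pi_gt_three, abs_nonneg (n : ℝ)]
  have h4 : |2 * Real.pi * n| ≤ |2 * Real.pi * n + t| + |t| := by
    simpa using abs_sub (2 * Real.pi * n + t) t
  have h5 : 1 + |K| + ‖lam‖ ≤ |2 * Real.pi * n + t| := by linarith
  have h6 := norm_nonneg lam
  have h7 := abs_nonneg K
  have h8 := le_abs_self K
  nlinarith

/-- A continuous function on `[0, 1]` with `t`-quasiperiodic boundary values vanishes if all its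
quasiperiodic Fourier coefficients do. -/
theorem eq_zero_of_forall_integral_quasiExp_eq_zero {y : ℝ → ℂ} (hy : Continuous y) {t : ℝ}
    (hbc : y 1 = Complex.exp (Complex.I * t) * y 0)
    (h : ∀ n : ℤ, ∫ x in (0 : ℝ)..1, y x * quasiExp (-t) (-n) x = 0) :
    ∀ x ∈ Set.Icc (0 : ℝ) 1, y x = 0 := by
  let g : ℝ → ℂ := fun x => y x * quasiExp (-t) 0 x
  have hg : Continuous g := hy.mul (continuous_quasiExp _ _)
  have hg01 : g 0 = g 1 := by
    simp only [g, quasiExp_zero, quasiExp_one, hbc]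
    rw [mul_right_comm, ← Complex.exp_add]
    simp
  have : Fact ((0 : ℝ) < 1) := ⟨one_pos⟩
  let F : C(AddCircle (1 : ℝ), ℂ) := ⟨AddCircle.liftIco 1 0 g,
    AddCircle.liftIco_continuous (by simpa using hg01) hg.continuousOn⟩
  have hF : ∀ n, fourierCoeff F n = 0 := by
    intro n
    change fourierCoeff (AddCircle.liftIco 1 0 g) n = 0
    rw [fourierCoeff_liftIco_eq, fourierCoeffOn_eq_integral]
    have : ∫ x in (0 : ℝ)..(0 + 1), fourier (-n) (x : AddCircle ((0 : ℝ) + 1 - 0)) • g x =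
        ∫ x in (0 : ℝ)..1, y x * quasiExp (-t) (-n) x := by
      rw [zero_add]
      refine intervalIntegral.integral_congr fun x _ => ?_
      have h1 : ∀ T : ℝ, T = 1 → (fourier (-n) (x : AddCircle T) : ℂ) = quasiExp 0 (-n) x := by
        rintro T rfl
        rw [fourier_coe_apply, quasiExp]
        congr 1
        push_cast
        ring
      have h2 := quasiExp_mul 0 (-t) (-n) 0 x
      simp only [zero_add, add_zero] at h2
      simp only [g, smul_eq_mul, h1 _ (sub_zero _), ← h2]
      ring
    rw [this, h n, smul_zero]
  have hF0 : F = 0 := by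
    have h0 : fourierCoeff F = 0 := funext hF
    have h1 := hasSum_fourier_series_of_summable (f := F) (by rw [h0]; exact summable_zero)
    simp only [hF, zero_smul] at h1
    exact h1.unique hasSum_zero
  have hIco : ∀ x ∈ Set.Ico (0 : ℝ) 1, y x = 0 := by
    intro x hx
    have h1 : F (x : AddCircle (1 : ℝ)) = g x :=
      AddCircle.liftIco_coe_apply (p := (1 : ℝ)) (a := 0) (f := g) (by simpa using hx)
    rw [hF0] at h1
    have h2 : quasiExp (-t) 0 x ≠ 0 := by
      rw [← norm_pos_iff, norm_quasiExp]; exact one_pos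
    simpa [g, h2] using h1.symm
  intro x hx
  rcases hx.2.lt_or_eq with h1 | rfl
  · exact hIco x ⟨hx.1, h1⟩
  · rw [hbc, hIco 0 (by simp), mul_zero]

theorem HasBoundedSol.of_isEigenvalueH {a b : ℂ} {t : ℝ} {lam : ℂ}
    (h : IsEigenvalueH a b t lam) : HasBoundedSol (hillSymbol t lam) a b := by
  obtain ⟨y, hy, hne, hode, hbc0, hbc1⟩ := h
  have hy0 : Continuous y := hy.continuous
  have hdiff : Differentiable ℝ y := hy.differentiable (by norm_num)
  have hy1 : ContDiff ℝ 1 (deriv y) := by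
    rw [show (2 : WithTop ℕ∞) = 1 + 1 by norm_num, contDiff_succ_iff_deriv] at hy
    exact hy.2.2
  have hdiff1 : Differentiable ℝ (deriv y) := hy1.differentiable (by norm_num)
  have hy2 : Continuous (deriv (deriv y)) := hy1.continuous_deriv le_rfl
  have hE := fun n : ℤ => continuous_quasiExp (-t) n
  refine ⟨fun n => ∫ x in (0 : ℝ)..1, y x * quasiExp (-t) (-n) x, fun h0 => hne ?_,
    ⟨∫ x in (0 : ℝ)..1, ‖y x‖, fun n => ?_⟩, fun n => ?_⟩
  · exact eq_zero_of_forall_integral_quasiExp_eq_zero hy0 hbc0 fun n => congrFun h0 n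
  · refine (intervalIntegral.norm_integral_le_integral_norm zero_le_one).trans (le_of_eq ?_)
    simp [norm_quasiExp]
  · have hexp : Complex.exp (Complex.I * t) * Complex.exp (Complex.I * (-t : ℝ)) = 1 := by
      rw [← Complex.exp_add]; simp
    have ibp : ∀ u : ℝ → ℂ, Differentiable ℝ u → Continuous (deriv u) →
        u 1 = Complex.exp (Complex.I * t) * u 0 →
        ∫ x in (0 : ℝ)..1, deriv u x * quasiExp (-t) (-n) x =
          Complex.I * (2 * Real.pi * n + t) * ∫ x in (0 : ℝ)..1, u x * quasiExp (-t) (-n) x := by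
      intro u hu hu' hub
      have h1 := intervalIntegral.integral_mul_deriv_eq_deriv_mul (a := 0) (b := 1)
        (fun x _ => (hu x).hasDerivAt)
        (fun x _ => hasDerivAt_quasiExp (-t) (-n) x) (hu'.intervalIntegrable _ _)
        ((continuous_const.mul (hE (-n))).intervalIntegrable _ _)
      rw [quasiExp_zero, quasiExp_one, hub, mul_right_comm (Complex.exp _) (u 0), hexp, one_mul,
        mul_one, sub_self, zero_sub] at h1
      have h2 : ∫ x in (0 : ℝ)..1, u x *
          (Complex.I * (2 * Real.pi * (-n : ℤ) + (-t : ℝ)) * quasiExp (-t) (-n) x) =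
          -(Complex.I * (2 * Real.pi * n + t)) *
            ∫ x in (0 : ℝ)..1, u x * quasiExp (-t) (-n) x := by
        rw [← intervalIntegral.integral_const_mul]
        congr 1
        funext x
        push_cast
        ring
      rw [h2] at h1
      linear_combination h1
    have e1 := ibp y hdiff hy1.continuous hbc0
    have e2 := ibp (deriv y) hdiff1 hy2 hbc1
    rw [e1] at e2
    have hshift : ∀ k : ℤ, ∀ x, quasiExp (-t) (-(n + k)) x =
        quasiExp 0 (-k) x * quasiExp (-t) (-n) x := by
      intro k x
      rw [quasiExp_mul, zero_add, neg_add_rev]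
    have hI : ∀ m : ℤ, IntervalIntegrable (fun x => y x * quasiExp (-t) m x)
        MeasureTheory.volume 0 1 := fun m => (hy0.mul (hE m)).intervalIntegrable _ _
    have e3 : ∫ x in (0 : ℝ)..1, deriv (deriv y) x * quasiExp (-t) (-n) x =
        ∫ x in (0 : ℝ)..1, (a * (y x * quasiExp (-t) (-(n + 1)) x) +
          b * (y x * quasiExp (-t) (-(n - 1)) x) - lam * (y x * quasiExp (-t) (-n) x)) := by
      refine intervalIntegral.integral_congr fun x hx => ?_
      rw [Set.uIcc_of_le zero_le_one] at hx
      have h1 := hode x hx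
      rw [mathieuPot_eq] at h1
      have h2 := hshift 1 x
      have h3 := hshift (-1) x
      rw [← sub_eq_add_neg, neg_neg] at h3
      simp only [h2, h3]
      linear_combination (-quasiExp (-t) (-n) x) * h1
    rw [intervalIntegral.integral_sub (((hI _).const_mul a).add ((hI _).const_mul b))
      ((hI _).const_mul lam), intervalIntegral.integral_add ((hI _).const_mul a)
      ((hI _).const_mul b), intervalIntegral.integral_const_mul,
      intervalIntegral.integral_const_mul, intervalIntegral.integral_const_mul, e2] at e3
    simp only [hillSymbol]
    linear_combination -e3 + (2 * Real.pi * n + t : ℂ) ^ 2 *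
      (∫ x in (0 : ℝ)..1, y x * quasiExp (-t) (-n) x) * Complex.I_sq

theorem summable_pow_mul_inv_two_pow_natAbs (A : ℝ) (k : ℕ) :
    Summable fun n : ℤ => (A * (n.natAbs + 1)) ^ k * (1 / 2 : ℝ) ^ n.natAbs := by
  have h : Summable fun n : ℕ => (A * (n + 1)) ^ k * (1 / 2 : ℝ) ^ n := by
    have h1 := (summable_nat_add_iff 1).mpr
      (summable_pow_mul_geometric_of_norm_lt_one k (r := (1 / 2 : ℝ)) (by norm_num))
    refine (h1.mul_left (2 * A ^ k)).congr fun n => ?_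
    push_cast
    rw [mul_pow, pow_succ]
    ring
  exact Summable.of_nat_of_neg (by simpa using h) (by simpa using h)

theorem summable_norm_mul_frequency_pow {c : ℤ → ℂ} {C : ℝ}
    (hC : ∀ n : ℤ, ‖c n‖ * 2 ^ n.natAbs ≤ C) (t : ℝ) (k : ℕ) :
    Summable fun n : ℤ => ‖c n * (Complex.I * (2 * Real.pi * n + t)) ^ k‖ := by
  refine Summable.of_nonneg_of_le (fun _ => norm_nonneg _) (fun n => ?_)
    ((summable_pow_mul_inv_two_pow_natAbs (2 * Real.pi + |t|) k).mul_left C)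
  have h1 : ‖c n‖ ≤ C * (1 / 2 : ℝ) ^ n.natAbs := by
    rw [one_div, inv_pow, ← div_eq_mul_inv, le_div_iff₀ (by positivity)]
    exact hC n
  have h2 : ‖Complex.I * (2 * Real.pi * n + t)‖ ≤ (2 * Real.pi + |t|) * (n.natAbs + 1) := by
    rw [norm_mul, Complex.norm_I, one_mul]
    have h3 : ‖(2 * Real.pi * n + t : ℂ)‖ ≤ 2 * Real.pi * |(n : ℝ)| + |t| := by
      rw [show (2 * Real.pi * n + t : ℂ) = ((2 * Real.pi * n + t : ℝ) : ℂ) by push_cast; ring,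
        Complex.norm_real, Real.norm_eq_abs]
      refine (abs_add_le _ _).trans (le_of_eq ?_)
      rw [abs_mul, abs_of_pos (by positivity : 0 < 2 * Real.pi)]
    have h4 : |(n : ℝ)| = n.natAbs := by
      rw [← Int.cast_abs, Int.abs_eq_natAbs]; simp
    rw [h4] at h3
    have : (0 : ℝ) ≤ n.natAbs := by positivity
    nlinarith [Real.pi_pos, abs_nonneg t]
  rw [norm_mul, norm_pow]
  calc ‖c n‖ * ‖Complex.I * (2 * Real.pi * n + t)‖ ^ k
      ≤ (C * (1 / 2 : ℝ) ^ n.natAbs) * ((2 * Real.pi + |t|) * (n.natAbs + 1)) ^ k := by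
        gcongr
        exact (norm_nonneg _).trans h1
    _ = _ := by ring

/-- The `k`-th derivative of the series `∑ c n * exp(i(2πn + t)x)`, taken termwise. -/
noncomputable def quasiSeries (c : ℤ → ℂ) (t : ℝ) (k : ℕ) (x : ℝ) : ℂ :=
  ∑' n : ℤ, c n * (Complex.I * (2 * Real.pi * n + t)) ^ k * quasiExp t n x

theorem summable_quasiSeries {c : ℤ → ℂ} {C : ℝ} (hC : ∀ n : ℤ, ‖c n‖ * 2 ^ n.natAbs ≤ C)
    (t : ℝ) (k : ℕ) (x : ℝ) :
    Summable fun n : ℤ => c n * (Complex.I * (2 * Real.pi * n + t)) ^ k * quasiExp t n x := by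
  refine Summable.of_norm ((summable_norm_mul_frequency_pow hC t k).congr fun n => ?_)
  rw [norm_mul _ (quasiExp t n x), norm_quasiExp, mul_one]

theorem hasDerivAt_quasiSeries {c : ℤ → ℂ} {C : ℝ} (hC : ∀ n : ℤ, ‖c n‖ * 2 ^ n.natAbs ≤ C)
    (t : ℝ) (k : ℕ) (x : ℝ) :
    HasDerivAt (quasiSeries c t k) (quasiSeries c t (k + 1) x) x := by
  refine hasDerivAt_tsum
    (g := fun n x => c n * (Complex.I * (2 * Real.pi * n + t)) ^ k * quasiExp t n x)
    (g' := fun n x => c n * (Complex.I * (2 * Real.pi * n + t)) ^ (k + 1) * quasiExp t n x)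
    (y₀ := 0) (summable_norm_mul_frequency_pow hC t (k + 1))
    (fun n x => ?_) (fun n x => ?_) (summable_quasiSeries hC t k 0) x
  · rw [pow_succ, ← mul_assoc, mul_assoc _ _ (quasiExp t n x)]
    exact (hasDerivAt_quasiExp t n x).const_mul _
  · rw [norm_mul _ (quasiExp t n x), norm_quasiExp, mul_one]

theorem deriv_quasiSeries {c : ℤ → ℂ} {C : ℝ} (hC : ∀ n : ℤ, ‖c n‖ * 2 ^ n.natAbs ≤ C)
    (t : ℝ) (k : ℕ) : deriv (quasiSeries c t k) = quasiSeries c t (k + 1) :=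
  funext fun x => (hasDerivAt_quasiSeries hC t k x).deriv

theorem contDiff_quasiSeries {c : ℤ → ℂ} {C : ℝ} (hC : ∀ n : ℤ, ‖c n‖ * 2 ^ n.natAbs ≤ C)
    (t : ℝ) (m k : ℕ) : ContDiff ℝ m (quasiSeries c t k) := by
  induction m generalizing k with
  | zero =>
    exact contDiff_zero.mpr (continuous_iff_continuousAt.mpr fun x =>
      (hasDerivAt_quasiSeries hC t k x).continuousAt)
  | succ m ih =>
    rw [Nat.cast_succ, contDiff_succ_iff_deriv]
    refine ⟨fun x => (hasDerivAt_quasiSeries hC t k x).differentiableAt, by simp, ?_⟩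
    rw [deriv_quasiSeries hC]
    exact ih _

theorem quasiSeries_one (c : ℤ → ℂ) (t : ℝ) (k : ℕ) :
    quasiSeries c t k 1 = Complex.exp (Complex.I * t) * quasiSeries c t k 0 := by
  simp only [quasiSeries, quasiExp_one, quasiExp_zero, mul_one]
  rw [tsum_mul_right, mul_comm]

theorem integral_quasiSeries_mul_quasiExp {c : ℤ → ℂ} {C : ℝ}
    (hC : ∀ n : ℤ, ‖c n‖ * 2 ^ n.natAbs ≤ C)
    (t : ℝ) (m : ℤ) :
    ∫ x in (0 : ℝ)..1, quasiSeries c t 0 x * quasiExp (-t) (-m) x = c m := by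
  let f : ℤ → C(ℝ, ℂ) := fun n =>
    ⟨fun x => c n * quasiExp 0 (n - m) x, continuous_const.mul (continuous_quasiExp _ _)⟩
  have hf : HasSum (fun n => ∫ x in (0 : ℝ)..1, f n x) (∫ x in (0 : ℝ)..1, ∑' n, f n x) := by
    refine intervalIntegral.hasSum_intervalIntegral_of_summable_norm
      (Summable.of_nonneg_of_le (fun _ => norm_nonneg _) (fun n => ?_)
        (summable_norm_mul_frequency_pow hC t 0))
    refine (ContinuousMap.norm_le _ (norm_nonneg _)).mpr fun x => ?_
    simp [f, norm_quasiExp]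
  have h1 : ∀ n, ∫ x in (0 : ℝ)..1, f n x = if n = m then c m else 0 := by
    intro n
    change ∫ x in (0 : ℝ)..1, c n * quasiExp 0 (n - m) x = _
    rw [intervalIntegral.integral_const_mul, integral_quasiExp_zero]
    simp only [sub_eq_zero]
    split_ifs with h
    · rw [h, mul_one]
    · rw [mul_zero]
  simp only [h1] at hf
  refine Eq.trans ?_ (hf.unique (hasSum_ite_eq m (c m)))
  refine intervalIntegral.integral_congr fun x _ => ?_
  simp only [quasiSeries]
  rw [← tsum_mul_right]
  refine tsum_congr fun n => ?_
  rw [pow_zero, mul_one, mul_assoc, quasiExp_mul, add_neg_cancel, ← sub_eq_add_neg]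
  rfl

theorem quasiSeries_ode {c : ℤ → ℂ} {C : ℝ} (hC : ∀ n : ℤ, ‖c n‖ * 2 ^ n.natAbs ≤ C)
    (t : ℝ) {a b lam : ℂ}
    (hrec : IsRecurrenceSol (hillSymbol t lam) a b c) (x : ℝ) :
    -quasiSeries c t 2 x + mathieuPot a b x * quasiSeries c t 0 x =
      lam * quasiSeries c t 0 x := by
  have s0 := (summable_quasiSeries hC t 0 x).hasSum
  have s2 := (summable_quasiSeries hC t 2 x).hasSum
  have sa := (Equiv.addRight (1 : ℤ)).hasSum_iff.mpr (s0.mul_left (a * quasiExp 0 (-1) x))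
  have sb := (Equiv.subRight (1 : ℤ)).hasSum_iff.mpr (s0.mul_left (b * quasiExp 0 1 x))
  have key := ((s2.neg.add (sa.add sb)).sub (s0.mul_left lam)).unique
    (hasSum_zero.congr_fun fun n => ?_)
  · rw [mathieuPot_eq]
    simp only [quasiSeries]
    linear_combination key
  · have e1 := quasiExp_mul 0 t (-1) (n + 1) x
    have e2 := quasiExp_mul 0 t 1 (n - 1) x
    rw [zero_add, neg_add_cancel_comm_assoc] at e1
    rw [zero_add, add_sub_cancel] at e2
    have hn := hrec n
    simp only [hillSymbol] at hn
    simp only [Function.comp, Equiv.coe_addRight, Equiv.subRight_apply, pow_zero, mul_one]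
    linear_combination (quasiExp t n x) * hn + a * c (n + 1) * e1 + b * c (n - 1) * e2 -
      c n * (2 * Real.pi * n + t : ℂ) ^ 2 * quasiExp t n x * Complex.I_sq

theorem HasBoundedSol.isEigenvalueH {a b : ℂ} {t : ℝ} {lam : ℂ}
    (h : HasBoundedSol (hillSymbol t lam) a b) : IsEigenvalueH a b t lam := by
  obtain ⟨c, hc0, hcb, hrec⟩ := h
  obtain ⟨C, -, hC⟩ := hrec.exists_decay (normDiverges_hillSymbol t lam) hcb one_le_two
  refine ⟨quasiSeries c t 0, contDiff_quasiSeries hC t 2 0, fun h0 => hc0 ?_, fun x _ => ?_,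
    quasiSeries_one c t 0, ?_⟩
  · funext m
    rw [← integral_quasiSeries_mul_quasiExp hC t m, Pi.zero_apply]
    refine (intervalIntegral.integral_congr fun x hx => ?_).trans
      intervalIntegral.integral_zero
    rw [Set.uIcc_of_le zero_le_one] at hx
    simp [h0 x hx]
  · rw [deriv_quasiSeries hC, deriv_quasiSeries hC]
    exact quasiSeries_ode hC t hrec x
  · rw [deriv_quasiSeries hC]
    exact quasiSeries_one c t 1

theorem isEigenvalueH_iff_hasBoundedSol {a b : ℂ} {t : ℝ} {lam : ℂ} :
    IsEigenvalueH a b t lam ↔ HasBoundedSol (hillSymbol t lam) a b :=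
  ⟨HasBoundedSol.of_isEigenvalueH, HasBoundedSol.isEigenvalueH⟩

theorem isospectral_Ht_of_ab_eq_cd (a b c d : ℂ) (h : a * b = c * d) :
    ∀ t ∈ Set.Ioc (-Real.pi) Real.pi, ∀ lam : ℂ,
      IsEigenvalueH a b t lam ↔ IsEigenvalueH c d t lam := by
  intro t _ lam
  rw [isEigenvalueH_iff_hasBoundedSol, isEigenvalueH_iff_hasBoundedSol]
  exact hasBoundedSol_iff_of_mul_eq_mul (normDiverges_hillSymbol t lam) h
end

section
/- Let a, b be complex numbers and t ∈ [0, π]. Suppose (λ_n) is a sequence of complex numbers such that for all sufficiently large natural numbers n, λ_n is an eigenvalue of H_t(a,b) and |λ_n − (2πn + t)²| ≤ 1. Then 2·(2πn + t)²·(λ_n − (2πn + t)²) → ab as n → ∞. In particular, the product ab is determined by any such sequence of eigenvalues. -/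
open Real Complex Set

/-- The sequence of Fourier coefficients of a nonzero continuous function with matching endpoint
values attains its maximal modulus, at a nonzero coefficient. -/
lemma exists_max_fourierIntegral {f : ℝ → ℂ} (hf : Continuous f) (h01 : f 0 = f 1)
    (hne : ¬ ∀ x ∈ Set.Icc (0:ℝ) 1, f x = 0) :
    ∃ m : ℤ, (∫ x in (0:ℝ)..1, Complex.exp (-(2 * Real.pi * m * Complex.I) * x) * f x) ≠ 0 ∧
      ∀ k : ℤ, ‖∫ x in (0:ℝ)..1, Complex.exp (-(2 * Real.pi * k * Complex.I) * x) * f x‖ ≤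
        ‖∫ x in (0:ℝ)..1, Complex.exp (-(2 * Real.pi * m * Complex.I) * x) * f x‖ := by
  have : Fact ((0:ℝ) < 1) := ⟨one_pos⟩
  let g : C(AddCircle (1:ℝ), ℂ) := ⟨AddCircle.liftIco 1 0 f,
    AddCircle.liftIco_continuous (by simpa using h01) hf.continuousOn⟩
  have hg : ∀ x ∈ Set.Ico (0:ℝ) 1, g x = f x := fun x hx =>
    AddCircle.liftIco_coe_apply (by simpa using hx)
  have hc : ∀ k : ℤ, (∫ x in (0:ℝ)..1, Complex.exp (-(2 * Real.pi * k * Complex.I) * x) * f x) =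
      fourierCoeff g k := by
    intro k
    rw [fourierCoeff_eq_intervalIntegral g k 0]
    simp only [zero_add, div_one, one_smul]
    refine intervalIntegral.integral_congr_Ioo_of_le zero_le_one fun x hx => ?_
    simp only [fourier_coe_apply, smul_eq_mul, hg x ⟨hx.1.le, hx.2⟩]
    congr 2
    push_cast
    ring
  simp only [hc]
  have htend : Filter.Tendsto (fun k : ℤ => ‖fourierCoeff g k‖) Filter.cofinite (nhds 0) := by
    have h := (hasSum_sq_fourierCoeff
      (ContinuousMap.toLp (E := ℂ) 2 AddCircle.haarAddCircle ℂ g)).summable.tendsto_cofinite_zero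
    simp only [fourierCoeff_toLp] at h
    simpa using h.sqrt
  obtain ⟨k₀, hk₀⟩ : ∃ k, fourierCoeff g k ≠ 0 := by
    by_contra! h0
    have h0' : fourierCoeff g = 0 := funext h0
    have hs : Summable (fourierCoeff g) := by rw [h0']; exact summable_zero
    have hz : ∀ x, g x = 0 := fun x => by
      have h := has_pointwise_sum_fourier_series_of_summable hs x
      simp only [h0, zero_smul] at h
      exact h.unique hasSum_zero
    apply hne
    have hIco : ∀ x ∈ Set.Ico (0:ℝ) 1, f x = 0 := fun x hx => by rw [← hg x hx, hz]
    intro x hx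
    rcases hx.2.lt_or_eq with h | h
    · exact hIco x ⟨hx.1, h⟩
    · rw [h, ← h01]
      exact hIco 0 ⟨le_rfl, one_pos⟩
  obtain ⟨m, hm⟩ := (continuous_of_discreteTopology (f := fun k : ℤ => ‖fourierCoeff g k‖)
    ).exists_forall_ge' k₀ (by
      rw [Filter.cocompact_eq_cofinite]
      exact htend.eventually_le_const (norm_pos_iff.mpr hk₀))
  exact ⟨m, norm_pos_iff.mp ((norm_pos_iff.mpr hk₀).trans_le (hm k₀)), hm⟩

/-- Integrating a solution of the Mathieu equation with quasiperiodic boundary conditions against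
an exponential of matching quasiperiodicity yields a three-term recurrence. -/
lemma mathieu_recurrence {a b lam : ℂ} {t : ℝ} {y : ℝ → ℂ} (hy : ContDiff ℝ 2 y)
    (hode : ∀ x ∈ Set.Icc (0:ℝ) 1,
      -(deriv (deriv y) x) + mathieuPot a b x * y x = lam * y x)
    (h0 : y 1 = Complex.exp (Complex.I * t) * y 0)
    (h1 : deriv y 1 = Complex.exp (Complex.I * t) * deriv y 0)
    {c : ℤ → ℂ}
    (hc : ∀ k : ℤ, c k = ∫ x in (0:ℝ)..1,
      Complex.exp (-((2 * Real.pi * k + t) * Complex.I) * x) * y x) (k : ℤ) :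
    (lam - (2 * Real.pi * k + t) ^ 2) * c k = a * c (k + 1) + b * c (k - 1) := by
  have hdy : ∀ x, HasDerivAt y (deriv y x) x := fun x =>
    (hy.differentiable (by norm_num) x).hasDerivAt
  have hy' : ContDiff ℝ 1 (deriv y) := by
    have h2 : ContDiff ℝ (1 + 1) y := by simpa [one_add_one_eq_two] using hy
    exact (contDiff_succ_iff_deriv.mp h2).2.2
  have hddy : ∀ x, HasDerivAt (deriv y) (deriv (deriv y) x) x := fun x =>
    (hy'.differentiable (by norm_num) x).hasDerivAt
  have hcy := hy.continuous
  have hcy'' : Continuous (deriv (deriv y)) := hy'.continuous_deriv (by norm_num)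
  set ν : ℂ := 2 * Real.pi * k + t with hν
  have hE : ∀ x : ℝ, HasDerivAt (fun x : ℝ => Complex.exp (-(ν * Complex.I) * x))
      (-(ν * Complex.I) * Complex.exp (-(ν * Complex.I) * x)) x := by
    intro x
    have h := ((hasDerivAt_id (x : ℂ)).const_mul (-(ν * Complex.I))).cexp.comp_ofReal
    simpa [mul_comm] using h
  have hF : ∀ x : ℝ, HasDerivAt
      (fun x : ℝ => Complex.exp (-(ν * Complex.I) * x) * (deriv y x + ν * Complex.I * y x))
      (Complex.exp (-(ν * Complex.I) * x) * (deriv (deriv y) x + ν ^ 2 * y x)) x := by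
    intro x
    refine ((hE x).mul ((hddy x).add ((hdy x).const_mul (ν * Complex.I)))).congr_deriv ?_
    simp only [Pi.add_apply]
    linear_combination (-ν ^ 2 * y x * Complex.exp (-(ν * Complex.I) * x)) * Complex.I_sq
  have hint := intervalIntegral.integral_eq_sub_of_hasDerivAt (a := 0) (b := 1)
    (fun x _ => hF x) (Continuous.intervalIntegrable (by fun_prop) _ _)
  have hE1 : Complex.exp (-(ν * Complex.I) * (1:ℝ)) * Complex.exp (Complex.I * t) = 1 := by
    rw [← Complex.exp_add, Complex.exp_eq_one_iff]
    refine ⟨-k, ?_⟩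
    rw [hν]
    push_cast
    ring
  have hbd : (∫ x in (0:ℝ)..1, Complex.exp (-(ν * Complex.I) * x) *
      (deriv (deriv y) x + ν ^ 2 * y x)) = 0 := by
    rw [hint, h0, h1]
    simp only [Complex.ofReal_zero, mul_zero, Complex.exp_zero]
    linear_combination (deriv y 0 + ν * Complex.I * y 0) * hE1
  have hexp1 : ∀ x : ℝ, Complex.exp (-((2 * Real.pi * ((k + 1 : ℤ) : ℂ) + t) * Complex.I) * x) =
      Complex.exp (-(ν * Complex.I) * x) *
        Complex.exp (-(2 * Real.pi * Complex.I) * (x : ℂ)) := by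
    intro x
    rw [← Complex.exp_add, hν]
    push_cast
    ring_nf
  have hexp2 : ∀ x : ℝ, Complex.exp (-((2 * Real.pi * ((k - 1 : ℤ) : ℂ) + t) * Complex.I) * x) =
      Complex.exp (-(ν * Complex.I) * x) * Complex.exp (2 * Real.pi * Complex.I * (x : ℂ)) := by
    intro x
    rw [← Complex.exp_add, hν]
    push_cast
    ring_nf
  have hint' : ∀ z : ℂ, IntervalIntegrable (fun x : ℝ => Complex.exp (-(z * Complex.I) * x) * y x)
      MeasureTheory.volume 0 1 := fun z => Continuous.intervalIntegrable (by fun_prop) _ _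
  rw [hc, hc, hc, ← hν, ← intervalIntegral.integral_const_mul,
    ← intervalIntegral.integral_const_mul, ← intervalIntegral.integral_const_mul,
    ← intervalIntegral.integral_add ((hint' _).const_mul _) ((hint' _).const_mul _),
    ← sub_eq_zero, ← intervalIntegral.integral_sub ((hint' _).const_mul _)
      (((hint' _).const_mul _).add ((hint' _).const_mul _)), ← neg_eq_zero,
    ← intervalIntegral.integral_neg, ← hbd]
  refine intervalIntegral.integral_congr fun x hx => ?_
  rw [Set.uIcc_of_le zero_le_one] at hx
  have hode_x := hode x hx
  simp only [mathieuPot] at hode_x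
  simp only [hexp1, hexp2]
  linear_combination (Complex.exp (-(ν * Complex.I) * x)) * hode_x

/-- An eigenvalue yields a solution of the three-term recurrence whose modulus is maximal
at some index, normalized to be `1` there. -/
lemma IsEigenvalueH.exists_recurrence {a b lam : ℂ} {t : ℝ} (h : IsEigenvalueH a b t lam) :
    ∃ (m : ℤ) (d : ℤ → ℂ), d 0 = 1 ∧ (∀ j, ‖d j‖ ≤ 1) ∧
      ∀ j : ℤ, (lam - ((2 * Real.pi * m + t : ℝ) + 2 * Real.pi * j) ^ 2) * d j =
        a * d (j + 1) + b * d (j - 1) := by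
  obtain ⟨y, hy, hne, hode, h0, h1⟩ := h
  let c : ℤ → ℂ := fun k => ∫ x in (0:ℝ)..1,
      Complex.exp (-((2 * Real.pi * k + t) * Complex.I) * x) * y x
  have hrec := mathieu_recurrence hy hode h0 h1 (c := c) fun _ => rfl
  have hcy := hy.continuous
  obtain ⟨m, hm0, hm⟩ := exists_max_fourierIntegral
    (f := fun x : ℝ => Complex.exp (-(t * Complex.I) * x) * y x) (by fun_prop)
    (by
      rw [h0, ← mul_assoc, ← Complex.exp_add]
      simp [mul_comm])
    (fun hz => hne fun x hx => by simpa using hz x hx)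
  have hcf : ∀ k : ℤ, (∫ x in (0:ℝ)..1, Complex.exp (-(2 * Real.pi * k * Complex.I) * x) *
      (Complex.exp (-(t * Complex.I) * x) * y x)) = c k := by
    intro k
    refine intervalIntegral.integral_congr fun x _ => ?_
    rw [← mul_assoc, ← Complex.exp_add]
    ring_nf
  simp only [hcf] at hm0 hm
  refine ⟨m, fun j => c (m + j) / c m, by simp [hm0], fun j => ?_, fun j => ?_⟩
  · rw [norm_div]
    exact div_le_one_of_le₀ (hm _) (norm_nonneg _)
  · have h := hrec (m + j)
    rw [add_assoc, add_sub_assoc] at h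
    field_simp
    rw [← h]
    push_cast
    ring

/-- For large `n`, a number `(2πm + t)²` within bounded distance of `(2πn + t)²` equals it. -/
lemma eventually_sq_eq_of_abs_sub_le {t : ℝ} (ht : t ∈ Set.Icc (0:ℝ) Real.pi) (K : ℝ) :
    ∀ᶠ n : ℕ in Filter.atTop, ∀ m : ℤ,
      |(2 * Real.pi * m + t) ^ 2 - (2 * Real.pi * n + t) ^ 2| ≤ K →
        (2 * Real.pi * m + t) ^ 2 = (2 * Real.pi * n + t) ^ 2 := by
  obtain ⟨ht0, ht1⟩ := ht
  have hpi := Real.pi_pos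
  have hgap : ∀ q : ℤ, q ≠ 0 → 2 * Real.pi ≤ |2 * Real.pi * q| := by
    intro q hq
    have h1 : (1:ℝ) ≤ |(q:ℝ)| := by exact_mod_cast Int.one_le_abs hq
    rw [abs_mul, abs_of_pos (by positivity : 0 < 2 * Real.pi)]
    nlinarith
  obtain ⟨δ, hδ, hδpi, hδq⟩ : ∃ δ : ℝ, 0 < δ ∧ δ ≤ 2 * Real.pi ∧
      ∀ q : ℤ, 2 * Real.pi * q + 2 * t = 0 ∨ δ ≤ |2 * Real.pi * q + 2 * t| := by
    rcases ht0.eq_or_lt with h0 | h0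
    · refine ⟨2 * Real.pi, by positivity, le_rfl, fun q => ?_⟩
      subst h0
      by_cases hq : q = 0
      · simp [hq]
      · right
        simpa using hgap q hq
    rcases ht1.eq_or_lt with h1 | h1
    · refine ⟨2 * Real.pi, by positivity, le_rfl, fun q => ?_⟩
      subst h1
      by_cases hq : q + 1 = 0
      · left
        have : (q:ℝ) + 1 = 0 := by exact_mod_cast hq
        linear_combination 2 * Real.pi * this
      · right
        have := hgap (q + 1) hq
        push_cast at this
        rwa [mul_add, mul_one] at this
    · refine ⟨min (2 * t) (2 * Real.pi - 2 * t), lt_min (by linarith) (by linarith),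
        (min_le_left _ _).trans (by linarith), fun q => Or.inr ?_⟩
      rcases le_or_gt 0 q with hq | hq
      · have hq' : (0:ℝ) ≤ q := by exact_mod_cast hq
        refine (min_le_left _ _).trans (le_trans ?_ (le_abs_self _))
        nlinarith
      · have hq' : (q:ℝ) ≤ -1 := by exact_mod_cast (by omega : q ≤ -1)
        refine (min_le_right _ _).trans (le_trans ?_ (neg_le_abs _))
        nlinarith
  have hω : Filter.Tendsto (fun n : ℕ => δ * (2 * Real.pi * n + t)) Filter.atTop Filter.atTop :=
    (Filter.tendsto_atTop_add_const_right _ _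
      (tendsto_natCast_atTop_atTop.const_mul_atTop (by positivity))).const_mul_atTop hδ
  filter_upwards [hω.eventually_gt_atTop K] with n hn m hm
  have hfac : (2 * Real.pi * m + t) ^ 2 - (2 * Real.pi * n + t) ^ 2 =
      (2 * Real.pi * ((m - n : ℤ) : ℝ)) * (2 * Real.pi * ((m + n : ℤ) : ℝ) + 2 * t) := by
    push_cast
    ring
  rw [← sub_eq_zero, hfac]
  rcases hδq (m + n) with hB | hB
  · rw [hB, mul_zero]
  by_cases hA : m - (n : ℤ) = 0
  · simp [hA]
  have hA' := hδpi.trans (hgap _ hA)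
  rw [hfac, abs_mul] at hm
  have hsum : 2 * (2 * Real.pi * n + t) ≤
      |2 * Real.pi * ((m - n : ℤ) : ℝ)| + |2 * Real.pi * ((m + n : ℤ) : ℝ) + 2 * t| := by
    have h1 := neg_le_abs (2 * Real.pi * ((m - n : ℤ) : ℝ))
    have h2 := le_abs_self (2 * Real.pi * ((m + n : ℤ) : ℝ) + 2 * t)
    push_cast at h1 h2 ⊢
    linarith
  exfalso
  generalize |2 * Real.pi * ((m - n : ℤ) : ℝ)| = A at *
  generalize |2 * Real.pi * ((m + n : ℤ) : ℝ) + 2 * t| = B at *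
  rcases le_total A B with hAB | hAB
  · nlinarith [mul_nonneg (sub_nonneg.mpr hA') (hδ.le.trans hB)]
  · nlinarith [mul_nonneg (sub_nonneg.mpr hB) (hδ.le.trans hA')]

/-- Second-order perturbation theory for a bounded normalized solution of the three-term recurrence
whose central site has energy `σ² + μ` with `σ` tending to infinity and `μ` bounded. -/
lemma tendsto_of_recurrence {a b : ℂ} {σ μ : ℕ → ℂ} {d : ℕ → ℤ → ℂ}
    (hσ : Filter.Tendsto σ Filter.atTop (Bornology.cobounded ℂ))
    (hμ : ∀ᶠ n in Filter.atTop, ‖μ n‖ ≤ 1)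
    (hd0 : ∀ᶠ n in Filter.atTop, d n 0 = 1)
    (hd1 : ∀ᶠ n in Filter.atTop, ∀ j, ‖d n j‖ ≤ 1)
    (hrec : ∀ᶠ n in Filter.atTop, ∀ j : ℤ,
      (σ n ^ 2 + μ n - (σ n + 2 * Real.pi * j) ^ 2) * d n j =
        a * d n (j + 1) + b * d n (j - 1)) :
    Filter.Tendsto (fun n => 2 * σ n ^ 2 * μ n) Filter.atTop (nhds (a * b)) := by
  have hpi : (Real.pi : ℂ) ≠ 0 := by exact_mod_cast Real.pi_ne_zero
  have hσ0 : ∀ᶠ n in Filter.atTop, σ n ≠ 0 := hσ.eventually_ne_cobounded 0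
  have hinv : Filter.Tendsto (fun n => (σ n)⁻¹) Filter.atTop (nhds 0) :=
    Filter.tendsto_inv₀_cobounded.comp hσ
  set D : ℤ → ℕ → ℂ := fun j n => σ n ^ 2 + μ n - (σ n + 2 * Real.pi * j) ^ 2 with hD
  have hbdd : ∀ {u v : ℕ → ℂ} {C : ℝ}, Filter.Tendsto u Filter.atTop (nhds 0) →
      (∀ᶠ n in Filter.atTop, ‖v n‖ ≤ C) →
      Filter.Tendsto (fun n => u n * v n) Filter.atTop (nhds 0) := fun hu hv =>
    hu.zero_mul_isBoundedUnder_le ⟨_, by simpa using hv⟩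
  have hquot : ∀ j : ℤ, Filter.Tendsto (fun n => D j n / σ n) Filter.atTop
      (nhds (-(4 * Real.pi * j))) := by
    intro j
    have h := ((hbdd hinv hμ).sub_const (4 * Real.pi * j)).sub
      (hinv.const_mul (4 * Real.pi ^ 2 * (j:ℂ) ^ 2))
    simp only [mul_zero, sub_zero, zero_sub] at h
    refine h.congr' ?_
    filter_upwards [hσ0] with n hn
    simp only [hD]
    field_simp
    ring
  have hlim : ∀ j : ℤ, j ≠ 0 → -(4 * Real.pi * j : ℂ) ≠ 0 := fun j hj => by
    have : (j:ℂ) ≠ 0 := by exact_mod_cast hj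
    simp [hpi, this]
  have hR : ∀ j : ℤ, j ≠ 0 → Filter.Tendsto (fun n => σ n / D j n) Filter.atTop
      (nhds (-(4 * Real.pi * j))⁻¹) := fun j hj => by
    simpa using (hquot j).inv₀ (hlim j hj)
  have hD0 : ∀ j : ℤ, j ≠ 0 → ∀ᶠ n in Filter.atTop, D j n ≠ 0 := fun j hj => by
    filter_upwards [(hquot j).eventually_ne (hlim j hj)] with n hn h
    exact hn (by rw [h, zero_div])
  have hσd : ∀ j : ℤ, j ≠ 0 → ∀ᶠ n in Filter.atTop,
      σ n * d n j = σ n / D j n * (a * d n (j + 1) + b * d n (j - 1)) := fun j hj => by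
    filter_upwards [hD0 j hj, hrec] with n hn hr
    rw [← hr j]
    change _ = σ n / D j n * (D j n * d n j)
    field_simp
  have hd : ∀ j : ℤ, j ≠ 0 → Filter.Tendsto (fun n => d n j) Filter.atTop (nhds 0) := by
    intro j hj
    have h := hbdd (C := ‖a‖ + ‖b‖) (by simpa using hinv.mul (hR j hj))
      (v := fun n => a * d n (j + 1) + b * d n (j - 1)) (by
        filter_upwards [hd1] with n hn
        refine (norm_add_le _ _).trans ?_
        rw [norm_mul, norm_mul]
        gcongr
        · exact mul_le_of_le_one_right (norm_nonneg _) (hn _)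
        · exact mul_le_of_le_one_right (norm_nonneg _) (hn _))
    refine h.congr' ?_
    filter_upwards [hσ0, hσd j hj] with n hn hs
    rw [mul_assoc, ← hs, inv_mul_cancel_left₀ hn]
  have hμ0 : Filter.Tendsto μ Filter.atTop (nhds 0) := by
    have h := ((hd 1 one_ne_zero).const_mul a).add ((hd (-1) (by norm_num)).const_mul b)
    simp only [mul_zero, add_zero] at h
    refine h.congr' ?_
    filter_upwards [hrec, hd0] with n hr h0
    have := hr 0
    simp only [h0, zero_add, zero_sub, Int.cast_zero] at this
    rw [← this]
    ring
  have hσd0 : ∀ j : ℤ, j ≠ 0 → j + 1 ≠ 0 → j - 1 ≠ 0 →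
      Filter.Tendsto (fun n => σ n * d n j) Filter.atTop (nhds 0) := by
    intro j hj hj1 hj2
    have h := (hR j hj).mul (((hd _ hj1).const_mul a).add ((hd _ hj2).const_mul b))
    simp only [mul_zero, add_zero] at h
    refine h.congr' ?_
    filter_upwards [hσd j hj] with n hs using hs.symm
  have h1 := hR 1 one_ne_zero
  have h2 := hR (-1) (by norm_num)
  have h := ((((hσd0 2 (by norm_num) (by norm_num) (by norm_num)).mul h1).const_mul (2 * a ^ 2)).add
    (((hσd0 (-2) (by norm_num) (by norm_num) (by norm_num)).mul h2).const_mul (2 * b ^ 2))).add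
    (((h1.mul h2).mul ((hμ0.const_mul 2).sub_const (8 * (Real.pi : ℂ) ^ 2))).const_mul (2 * a * b))
  have hval : 2 * a ^ 2 * (0 * (-(4 * Real.pi * ((1:ℤ):ℂ)))⁻¹) +
      2 * b ^ 2 * (0 * (-(4 * Real.pi * ((-1:ℤ):ℂ)))⁻¹) +
      2 * a * b * ((-(4 * Real.pi * ((1:ℤ):ℂ)))⁻¹ * (-(4 * Real.pi * ((-1:ℤ):ℂ)))⁻¹ *
        (2 * 0 - 8 * (Real.pi : ℂ) ^ 2)) = a * b := by
    push_cast
    field_simp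
    ring
  rw [hval] at h
  refine h.congr' ?_
  filter_upwards [hσd 1 one_ne_zero, hσd (-1) (by norm_num), hrec, hd0, hD0 1 one_ne_zero,
    hD0 (-1) (by norm_num)] with n hp hm hr h0 hD1 hD2
  have hr0 := hr 0
  simp only [h0, zero_add, zero_sub, Int.cast_zero] at hr0
  norm_num [h0] at hp hm
  have hsum : σ n * (σ n / D 1 n + σ n / D (-1) n) =
      σ n / D 1 n * (σ n / D (-1) n) * (2 * μ n - 8 * (Real.pi : ℂ) ^ 2) := by
    have : D 1 n + D (-1) n = 2 * μ n - 8 * (Real.pi : ℂ) ^ 2 := by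
      simp only [hD]
      push_cast
      ring
    rw [← this]
    field_simp
    ring
  linear_combination (-2 * a * b) * hsum - 2 * σ n * a * hp - 2 * σ n * b * hm - 2 * σ n ^ 2 * hr0

theorem ab_determined_by_eigenvalue_sequence (a b : ℂ) (t : ℝ)
    (ht : t ∈ Set.Icc (0:ℝ) Real.pi) (lam : ℕ → ℂ)
    (h : ∃ N : ℕ, ∀ n : ℕ, N ≤ n →
      IsEigenvalueH a b t (lam n) ∧
        ‖lam n - (((2 * Real.pi * n + t : ℝ) : ℂ))^2‖ ≤ 1) :
    Filter.Tendsto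
      (fun n : ℕ =>
        2 * (((2 * Real.pi * n + t : ℝ) : ℂ))^2 *
          (lam n - (((2 * Real.pi * n + t : ℝ) : ℂ))^2))
      Filter.atTop (nhds (a * b)) := by
  obtain ⟨N, hN⟩ := h
  choose! m d hd0 hd1 hrec using fun n hn => (hN n hn).1.exists_recurrence
  have hev := Filter.eventually_ge_atTop N
  set ω : ℕ → ℝ := fun n => 2 * Real.pi * n + t with hω
  set σ : ℕ → ℝ := fun n => 2 * Real.pi * m n + t with hσ
  have hsq : ∀ᶠ n in Filter.atTop, σ n ^ 2 = ω n ^ 2 := by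
    filter_upwards [hev, eventually_sq_eq_of_abs_sub_le ht (‖a‖ + ‖b‖ + 1)] with n hn hn'
    refine hn' (m n) ?_
    have h1 : ‖lam n - (σ n : ℂ) ^ 2‖ ≤ ‖a‖ + ‖b‖ := by
      have h0 := hrec n hn 0
      simp only [hd0 n hn, Int.cast_zero, mul_zero, add_zero, mul_one] at h0
      rw [h0]
      refine (norm_add_le _ _).trans ?_
      rw [norm_mul, norm_mul]
      gcongr
      · exact mul_le_of_le_one_right (norm_nonneg _) (hd1 n hn _)
      · exact mul_le_of_le_one_right (norm_nonneg _) (hd1 n hn _)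
    have h2 := (norm_sub_le _ _).trans (add_le_add (hN n hn).2 h1)
    rw [sub_sub_sub_cancel_left] at h2
    rw [← Real.norm_eq_abs, ← Complex.norm_real]
    push_cast at h2 ⊢
    simpa [hσ, hω, add_comm] using h2
  have hωtop : Filter.Tendsto ω Filter.atTop Filter.atTop :=
    Filter.tendsto_atTop_add_const_right _ _
      (tendsto_natCast_atTop_atTop.const_mul_atTop (by positivity))
  have hσtop : Filter.Tendsto (fun n => (σ n : ℂ)) Filter.atTop (Bornology.cobounded ℂ) := by
    rw [← tendsto_norm_atTop_iff_cobounded]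
    refine (Filter.tendsto_abs_atTop_atTop.comp hωtop).congr' ?_
    filter_upwards [hsq] with n hn
    rw [Complex.norm_real, Real.norm_eq_abs]
    exact ((sq_eq_sq_iff_abs_eq_abs _ _).mp hn).symm
  have hsqC : ∀ᶠ n in Filter.atTop, (σ n : ℂ) ^ 2 = (ω n : ℂ) ^ 2 := by
    filter_upwards [hsq] with n hn
    exact_mod_cast hn
  have key := tendsto_of_recurrence (a := a) (b := b) (d := d)
    (μ := fun n => lam n - (σ n : ℂ) ^ 2) hσtop
    (by
      filter_upwards [hev, hsqC] with n hn hs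
      rw [hs]
      exact (hN n hn).2)
    (by filter_upwards [hev] with n hn using hd0 n hn)
    (by filter_upwards [hev] with n hn using hd1 n hn)
    (by
      filter_upwards [hev] with n hn j
      rw [add_sub_cancel]
      exact hrec n hn j)
  refine key.congr' ?_
  filter_upwards [hsqC] with n hs
  rw [hs]
end

section
/- Let a, b be complex numbers and t ∈ (0, π). Suppose (λ_n) is a sequence of complex numbers such that for all sufficiently large natural numbers n, λ_n is an eigenvalue of H_t(a,b) and |λ_n − (2πn + t)²| ≤ 1. Then there exists a constant C > 0 such that |λ_n − (2πn + t)² − ab/(2·(2πn + t)²)| ≤ C·n^{−3} for all sufficiently large n. -/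
open Real Complex Set

/-- The `k`-th coefficient of `y` with respect to the `t`-quasiperiodic exponentials
`exp(i(2πk + t)x)` on `[0,1]`. -/
noncomputable def quasiFourierCoeff (t : ℝ) (y : ℝ → ℂ) (k : ℤ) : ℂ :=
  ∫ x in (0:ℝ)..1, Complex.exp (-(Complex.I * (2 * Real.pi * k + t)) * (x : ℂ)) * y x

theorem bddAbove_norm_quasiFourierCoeff (t : ℝ) {y : ℝ → ℂ} (hy : Continuous y) :
    BddAbove (Set.range fun k => ‖quasiFourierCoeff t y k‖) := by
  obtain ⟨M, hM⟩ := isCompact_Icc.exists_bound_of_continuousOn (s := Set.Icc (0:ℝ) 1)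
    hy.continuousOn
  refine ⟨M, ?_⟩
  rintro _ ⟨k, rfl⟩
  have h : ∀ x ∈ Set.uIoc (0:ℝ) 1,
      ‖Complex.exp (-(Complex.I * (2 * Real.pi * k + t)) * (x : ℂ)) * y x‖ ≤ M := fun x hx => by
    rw [Set.uIoc_of_le zero_le_one] at hx
    have he : ‖Complex.exp (-(Complex.I * (2 * Real.pi * k + t)) * (x : ℂ))‖ = 1 := by
      rw [Complex.norm_exp]
      simp
    rw [norm_mul, he, one_mul]
    exact hM x ⟨hx.1.le, hx.2⟩
  simpa only [quasiFourierCoeff, sub_zero, abs_one, mul_one] using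
    intervalIntegral.norm_integral_le_of_norm_le_const h

theorem exists_quasiFourierCoeff_ne_zero {t : ℝ} {y : ℝ → ℂ} (hy : Continuous y)
    (hper : y 1 = Complex.exp (Complex.I * t) * y 0)
    (hne : ¬ ∀ x ∈ Set.Icc (0:ℝ) 1, y x = 0) :
    ∃ k, quasiFourierCoeff t y k ≠ 0 := by
  by_contra! hzero
  apply hne
  have : Fact ((0:ℝ) < 1) := ⟨one_pos⟩
  set u : ℝ → ℂ := fun x => Complex.exp (-(Complex.I * t) * (x : ℂ)) * y x with hu
  have huc : Continuous u := by fun_prop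
  have hu01 : u 0 = u 1 := by
    simp only [hu, hper, ← mul_assoc, ← Complex.exp_add]
    simp
  let f : C(AddCircle (1:ℝ), ℂ) :=
    ⟨AddCircle.liftIco 1 0 u, AddCircle.liftIco_zero_continuous hu01 huc.continuousOn⟩
  have hf : fourierCoeff (f : AddCircle (1:ℝ) → ℂ) = 0 := by
    funext k
    change fourierCoeff (AddCircle.liftIco 1 0 u) k = 0
    rw [fourierCoeff_liftIco_eq, fourierCoeffOn_eq_integral, ← hzero k,
      quasiFourierCoeff]
    simp only [zero_add, sub_zero, div_one, one_smul]
    refine intervalIntegral.integral_congr fun x _ => ?_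
    simp only [fourier_coe_apply, hu, smul_eq_mul, ← mul_assoc, ← Complex.exp_add]
    congr 2
    push_cast
    ring
  have hfz : ∀ x, f x = 0 := fun x => by
    have h := has_pointwise_sum_fourier_series_of_summable (f := f)
      (by rw [hf]; exact summable_zero) x
    simp only [hf, Pi.zero_apply, zero_smul] at h
    exact h.unique hasSum_zero
  have hIco : ∀ x ∈ Set.Ico (0:ℝ) 1, y x = 0 := fun x hx => by
    have h : u x = 0 := by
      rw [← AddCircle.liftIco_zero_coe_apply (f := u) hx]
      exact hfz x
    simpa [hu] using h
  intro x hx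
  rcases hx.2.lt_or_eq with h | rfl
  · exact hIco x ⟨hx.1, h⟩
  · rw [hper, hIco 0 ⟨le_rfl, one_pos⟩, mul_zero]

theorem quasiFourierCoeff_recurrence {a b lam : ℂ} {t : ℝ} {y : ℝ → ℂ} (hy : ContDiff ℝ 2 y)
    (hode : ∀ x ∈ Set.Icc (0:ℝ) 1,
      -(deriv (deriv y) x) + mathieuPot a b x * y x = lam * y x)
    (h0 : y 1 = Complex.exp (Complex.I * t) * y 0)
    (h1 : deriv y 1 = Complex.exp (Complex.I * t) * deriv y 0) (k : ℤ) :
    (lam - (2 * Real.pi * k + t) ^ 2) * quasiFourierCoeff t y k =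
      a * quasiFourierCoeff t y (k + 1) + b * quasiFourierCoeff t y (k - 1) := by
  have hyc : Continuous y := hy.continuous
  have hy1 : ContDiff ℝ 1 (deriv y) := by
    have : ContDiff ℝ (1 + 1) y := by simpa [one_add_one_eq_two] using hy
    exact (contDiff_succ_iff_deriv.mp this).2.2
  have hd0 : ∀ x, HasDerivAt y (deriv y x) x := fun x =>
    (hy.differentiable (by norm_num) x).hasDerivAt
  have hd1 : ∀ x, HasDerivAt (deriv y) (deriv (deriv y) x) x := fun x =>
    (hy1.differentiable (by norm_num) x).hasDerivAt
  have hc2 : Continuous (deriv (deriv y)) := hy1.continuous_deriv le_rfl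
  set w : ℂ := 2 * Real.pi * k + t with hw
  set e : ℝ → ℂ := fun x => Complex.exp (-(Complex.I * w) * (x : ℂ)) with he
  have hec : Continuous e := by fun_prop
  have hde : ∀ x, HasDerivAt e (e x * -(Complex.I * w)) x := fun x => by
    have := ((Complex.ofRealCLM.hasDerivAt (x := x)).const_mul (-(Complex.I * w))).cexp
    simpa [he] using this
  have hint : ∫ x in (0:ℝ)..1, e x * (deriv (deriv y) x + w ^ 2 * y x) = 0 := by
    have hF : ∀ x, HasDerivAt (fun x => e x * (deriv y x + Complex.I * w * y x))
        (e x * (deriv (deriv y) x + w ^ 2 * y x)) x := fun x => by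
      refine ((hde x).mul ((hd1 x).add ((hd0 x).const_mul (Complex.I * w)))).congr_deriv ?_
      simp only [Pi.add_apply]
      linear_combination (-(e x) * w ^ 2 * y x) * Complex.I_sq
    rw [intervalIntegral.integral_eq_sub_of_hasDerivAt (fun x _ => hF x)
      (by apply Continuous.intervalIntegrable; fun_prop)]
    have hexp : e 1 * Complex.exp (Complex.I * t) = 1 := by
      simp only [he, hw, ← Complex.exp_add]
      rw [Complex.exp_eq_one_iff]
      refine ⟨-k, ?_⟩
      push_cast
      ring
    have he0 : e 0 = 1 := by simp [he]
    rw [h0, h1, he0]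
    linear_combination (deriv y 0 + Complex.I * w * y 0) * hexp
  have hshift : ∀ x, e x * mathieuPot a b x =
      a * Complex.exp (-(Complex.I * (2 * Real.pi * (k + 1 : ℤ) + t)) * (x : ℂ)) +
      b * Complex.exp (-(Complex.I * (2 * Real.pi * (k - 1 : ℤ) + t)) * (x : ℂ)) := fun x => by
    simp only [he, hw, mathieuPot, mul_add, mul_left_comm _ a, mul_left_comm _ b,
      ← Complex.exp_add]
    congr 3 <;> (push_cast; ring)
  have hsplit : ∫ x in (0:ℝ)..1, e x * (deriv (deriv y) x + w ^ 2 * y x) =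
      ∫ x in (0:ℝ)..1,
        (a * (Complex.exp (-(Complex.I * (2 * Real.pi * (k + 1 : ℤ) + t)) * (x : ℂ)) * y x) +
        b * (Complex.exp (-(Complex.I * (2 * Real.pi * (k - 1 : ℤ) + t)) * (x : ℂ)) * y x)) -
        (lam - w ^ 2) * (e x * y x) := by
    refine intervalIntegral.integral_congr fun x hx => ?_
    rw [Set.uIcc_of_le zero_le_one] at hx
    linear_combination y x * hshift x - e x * hode x hx
  rw [hsplit, intervalIntegral.integral_sub, intervalIntegral.integral_add,
    intervalIntegral.integral_const_mul, intervalIntegral.integral_const_mul,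
    intervalIntegral.integral_const_mul, sub_eq_zero] at hint
  · exact hint.symm
  all_goals
    apply Continuous.intervalIntegrable
    fun_prop

theorem exists_quasimomentum_gap {t : ℝ} (ht : t ∈ Set.Ioo (0:ℝ) Real.pi) :
    ∃ κ : ℝ, 0 < κ ∧ ∀ n : ℕ, ∀ k : ℤ, k ≠ n →
      κ * n ≤ |(2 * Real.pi * n + t) ^ 2 - (2 * Real.pi * k + t) ^ 2| := by
  obtain ⟨h0, h1⟩ := ht
  have hpi := Real.pi_gt_three
  set η := min t (Real.pi - t) with hη
  have hηpos : 0 < η := lt_min h0 (by linarith)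
  have hη1 : η ≤ t := min_le_left _ _
  have hη2 : η ≤ Real.pi - t := min_le_right _ _
  refine ⟨η, hηpos, fun n k hk => ?_⟩
  have hfac : (2 * Real.pi * n + t) ^ 2 - (2 * Real.pi * k + t) ^ 2 =
      (2 * Real.pi * (n - k)) * (2 * (Real.pi * (n + k) + t)) := by ring
  rw [hfac, abs_mul]
  have hn0 : (0:ℝ) ≤ n := n.cast_nonneg
  have hsum : η ≤ |2 * (Real.pi * (n + k) + t)| := by
    rcases le_or_gt 0 ((n:ℤ) + k) with hm | hm
    · have : (0:ℝ) ≤ n + k := by exact_mod_cast hm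
      refine le_trans ?_ (le_abs_self _)
      nlinarith
    · have : ((n:ℝ) + k) ≤ -1 := by exact_mod_cast (by omega : (n:ℤ) + k ≤ -1)
      refine le_trans ?_ (neg_le_abs _)
      nlinarith
  by_cases hd : (n:ℤ) ≤ |(n:ℤ) - k|
  · have hd' : (n:ℝ) ≤ |(n:ℝ) - k| := by exact_mod_cast hd
    have : (n:ℝ) ≤ |2 * Real.pi * ((n:ℝ) - k)| := by
      rw [abs_mul, abs_of_pos (by positivity)]
      nlinarith
    nlinarith [abs_nonneg (2 * Real.pi * ((n:ℝ) - k))]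
  · have hd1 : (1:ℝ) ≤ |(n:ℝ) - k| := by
      exact_mod_cast Int.one_le_abs (sub_ne_zero.mpr (Ne.symm hk))
    have hk0 : (0:ℝ) ≤ k := by
      have : (0:ℤ) ≤ k := by
        rw [not_le, abs_lt] at hd
        omega
      exact_mod_cast this
    have h2 : 2 * Real.pi ≤ |2 * Real.pi * ((n:ℝ) - k)| := by
      rw [abs_mul, abs_of_pos (by positivity)]
      nlinarith
    have h3 : (n:ℝ) ≤ |2 * (Real.pi * (n + k) + t)| := by
      refine le_trans ?_ (le_abs_self _)
      nlinarith
    have h4 : η ≤ 2 * Real.pi := by linarith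
    exact mul_le_mul (h4.trans h2) h3 hn0 (abs_nonneg _)

section Recurrence

variable {a b lam : ℂ} {μ c : ℤ → ℂ} {n : ℤ} {L : ℝ}

theorem norm_recurrence_le (hL : 0 < L)
    (hrec : ∀ k, (lam - μ k) * c k = a * c (k + 1) + b * c (k - 1))
    {k : ℤ} (hk : L ≤ ‖lam - μ k‖) {M : ℝ}
    (h1 : ‖c (k + 1)‖ ≤ M) (h2 : ‖c (k - 1)‖ ≤ M) :
    ‖c k‖ ≤ (‖a‖ + ‖b‖) / L * M := by
  have h : L * ‖c k‖ ≤ (‖a‖ + ‖b‖) * M := by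
    calc L * ‖c k‖ ≤ ‖lam - μ k‖ * ‖c k‖ := by gcongr
      _ = ‖a * c (k + 1) + b * c (k - 1)‖ := by rw [← norm_mul, hrec]
      _ ≤ ‖a‖ * ‖c (k + 1)‖ + ‖b‖ * ‖c (k - 1)‖ := by
        simpa only [norm_mul] using norm_add_le (a * c (k + 1)) (b * c (k - 1))
      _ ≤ ‖a‖ * M + ‖b‖ * M := by gcongr
      _ = _ := by ring
  rw [div_mul_eq_mul_div, le_div_iff₀ hL]
  linarith

theorem norm_le_norm_of_recurrence (hL : 0 < L) (hab : 2 * (‖a‖ + ‖b‖) ≤ L)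
    (hrec : ∀ k, (lam - μ k) * c k = a * c (k + 1) + b * c (k - 1))
    (hgap : ∀ k, k ≠ n → L ≤ ‖lam - μ k‖)
    (hbdd : BddAbove (Set.range fun k => ‖c k‖)) (k : ℤ) :
    ‖c k‖ ≤ ‖c n‖ := by
  set M := ⨆ k, ‖c k‖ with hM
  have hle : ∀ k, ‖c k‖ ≤ M := fun k => le_ciSup hbdd k
  have hM0 : 0 ≤ M := (norm_nonneg _).trans (hle n)
  have hhalf : ∀ k, k ≠ n → ‖c k‖ ≤ M / 2 := fun k hk => by
    refine (norm_recurrence_le hL hrec (hgap k hk) (hle _) (hle _)).trans ?_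
    have : (‖a‖ + ‖b‖) / L ≤ 1 / 2 := by
      rw [div_le_div_iff₀ hL two_pos]; linarith
    nlinarith
  have hmax : M ≤ max ‖c n‖ (M / 2) := ciSup_le fun k => by
    by_cases hk : k = n
    · exact hk ▸ le_max_left _ _
    · exact (hhalf k hk).trans (le_max_right _ _)
  rcases le_max_iff.mp hmax with h | h
  · exact (hle k).trans h
  · exact (hle k).trans (by linarith [norm_nonneg (c n)])

theorem eigenvalue_estimate_of_recurrence (hL : 0 < L) (hab : 2 * (‖a‖ + ‖b‖) ≤ L)
    (hrec : ∀ k, (lam - μ k) * c k = a * c (k + 1) + b * c (k - 1))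
    (hgap : ∀ k, k ≠ n → L ≤ ‖lam - μ k‖)
    (hbdd : BddAbove (Set.range fun k => ‖c k‖)) (hc : ∃ k, c k ≠ 0) :
    ‖lam - μ n‖ ≤ (‖a‖ + ‖b‖) ^ 2 / L ∧
    ‖lam - μ n - a * b * (1 / (lam - μ (n + 1)) + 1 / (lam - μ (n - 1)))‖
      ≤ (‖a‖ + ‖b‖) ^ 4 / L ^ 3 := by
  set Q := ‖a‖ + ‖b‖ with hQ
  have hQ0 : 0 ≤ Q := by positivity
  have hle := norm_le_norm_of_recurrence hL hab hrec hgap hbdd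
  have hcn : 0 < ‖c n‖ := by
    obtain ⟨k, hk⟩ := hc
    exact (norm_pos_iff.mpr hk).trans_le (hle k)
  have hcn0 : c n ≠ 0 := norm_pos_iff.mp hcn
  have h1 : ∀ k, k ≠ n → ‖c k‖ ≤ Q / L * ‖c n‖ := fun k hk =>
    norm_recurrence_le hL hrec (hgap k hk) (hle _) (hle _)
  have h2 : ∀ k, k ≠ n → k + 1 ≠ n → k - 1 ≠ n → ‖c k‖ ≤ Q / L * (Q / L * ‖c n‖) :=
    fun k hk hk1 hk2 => norm_recurrence_le hL hrec (hgap k hk) (h1 _ hk1) (h1 _ hk2)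
  have hp := hgap (n + 1) (by omega)
  have hm := hgap (n - 1) (by omega)
  have hp0 : lam - μ (n + 1) ≠ 0 := norm_pos_iff.mp (hL.trans_le hp)
  have hm0 : lam - μ (n - 1) ≠ 0 := norm_pos_iff.mp (hL.trans_le hm)
  constructor
  · have h : ‖lam - μ n‖ * ‖c n‖ ≤ Q ^ 2 / L * ‖c n‖ := by
      calc ‖lam - μ n‖ * ‖c n‖ = ‖a * c (n + 1) + b * c (n - 1)‖ := by rw [← norm_mul, hrec]
        _ ≤ ‖a‖ * ‖c (n + 1)‖ + ‖b‖ * ‖c (n - 1)‖ := by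
          simpa only [norm_mul] using norm_add_le (a * c (n + 1)) (b * c (n - 1))
        _ ≤ ‖a‖ * (Q / L * ‖c n‖) + ‖b‖ * (Q / L * ‖c n‖) := by
          gcongr
          · exact h1 _ (by omega)
          · exact h1 _ (by omega)
        _ = _ := by rw [← add_mul, ← hQ]; ring
    exact le_of_mul_le_mul_right h hcn
  · have hrp := hrec (n + 1)
    have hrm := hrec (n - 1)
    rw [show n + 1 + 1 = n + 2 by ring, show n + 1 - 1 = n by ring] at hrp
    rw [show n - 1 + 1 = n by ring, show n - 1 - 1 = n - 2 by ring] at hrm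
    have key : (lam - μ n - a * b * (1 / (lam - μ (n + 1)) + 1 / (lam - μ (n - 1)))) * c n =
        a ^ 2 * c (n + 2) / (lam - μ (n + 1)) + b ^ 2 * c (n - 2) / (lam - μ (n - 1)) := by
      have e1 : c (n + 1) = (a * c (n + 2) + b * c n) / (lam - μ (n + 1)) := by
        rw [eq_div_iff hp0, ← hrp]; ring
      have e2 : c (n - 1) = (a * c n + b * c (n - 2)) / (lam - μ (n - 1)) := by
        rw [eq_div_iff hm0, ← hrm]; ring
      rw [sub_mul, hrec, e1, e2]
      ring
    have hp2 := h2 (n + 2) (by omega) (by omega) (by omega)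
    have hm2 := h2 (n - 2) (by omega) (by omega) (by omega)
    have h : ‖lam - μ n - a * b * (1 / (lam - μ (n + 1)) + 1 / (lam - μ (n - 1)))‖ * ‖c n‖
        ≤ Q ^ 4 / L ^ 3 * ‖c n‖ := by
      rw [← norm_mul, key]
      calc _ ≤ ‖a‖ ^ 2 * ‖c (n + 2)‖ / ‖lam - μ (n + 1)‖ +
            ‖b‖ ^ 2 * ‖c (n - 2)‖ / ‖lam - μ (n - 1)‖ := by
            refine (norm_add_le _ _).trans_eq ?_
            rw [norm_div, norm_div, norm_mul, norm_mul, norm_pow, norm_pow]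
        _ ≤ ‖a‖ ^ 2 * (Q / L * (Q / L * ‖c n‖)) / L +
            ‖b‖ ^ 2 * (Q / L * (Q / L * ‖c n‖)) / L := by gcongr
        _ = (‖a‖ ^ 2 + ‖b‖ ^ 2) * (Q ^ 2 / L ^ 3 * ‖c n‖) := by ring
        _ ≤ Q ^ 2 * (Q ^ 2 / L ^ 3 * ‖c n‖) := by
          gcongr
          rw [hQ]
          nlinarith [mul_nonneg (norm_nonneg a) (norm_nonneg b)]
        _ = _ := by ring
    exact le_of_mul_le_mul_right h hcn

end Recurrence

theorem norm_resolvent_sum_sub_le {s δ p : ℂ} {L D : ℝ} (hL : 0 < L) (hs : s ≠ 0)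
    (hδ : ‖δ‖ ≤ 1) (hδ' : ‖δ‖ ≤ D / L)
    (hp : L ≤ ‖s ^ 2 + δ - (s + p) ^ 2‖) (hm : L ≤ ‖s ^ 2 + δ - (s - p) ^ 2‖) :
    ‖1 / (s ^ 2 + δ - (s + p) ^ 2) + 1 / (s ^ 2 + δ - (s - p) ^ 2) - 1 / (2 * s ^ 2)‖
      ≤ 2 * D / L ^ 3 + (1 + ‖p‖ ^ 2) ^ 2 / (2 * ‖s‖ ^ 2 * L ^ 2) := by
  have hp0 : s ^ 2 + δ - (s + p) ^ 2 ≠ 0 := norm_pos_iff.mp (hL.trans_le hp)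
  have hm0 : s ^ 2 + δ - (s - p) ^ 2 ≠ 0 := norm_pos_iff.mp (hL.trans_le hm)
  have hs0 : 0 < ‖s‖ := norm_pos_iff.mpr hs
  have key : 1 / (s ^ 2 + δ - (s + p) ^ 2) + 1 / (s ^ 2 + δ - (s - p) ^ 2) - 1 / (2 * s ^ 2) =
      (4 * s ^ 2 * δ - (δ - p ^ 2) ^ 2) /
        (2 * s ^ 2 * ((s ^ 2 + δ - (s + p) ^ 2) * (s ^ 2 + δ - (s - p) ^ 2))) := by
    field_simp
    ring
  rw [key, norm_div]
  have hnum : ‖4 * s ^ 2 * δ - (δ - p ^ 2) ^ 2‖ ≤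
      4 * ‖s‖ ^ 2 * (D / L) + (1 + ‖p‖ ^ 2) ^ 2 := by
    refine (norm_sub_le _ _).trans ?_
    have h : ‖δ - p ^ 2‖ ≤ 1 + ‖p‖ ^ 2 := by
      refine (norm_sub_le _ _).trans ?_
      rw [norm_pow]; gcongr
    simp only [norm_mul, norm_pow, Complex.norm_ofNat]
    gcongr
  have hden : 2 * ‖s‖ ^ 2 * (L * L) ≤
      ‖2 * s ^ 2 * ((s ^ 2 + δ - (s + p) ^ 2) * (s ^ 2 + δ - (s - p) ^ 2))‖ := by
    simp only [norm_mul, norm_pow, Complex.norm_ofNat] at hp hm ⊢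
    gcongr
  have hD : 0 ≤ D / L := (norm_nonneg _).trans hδ'
  calc _ ≤ (4 * ‖s‖ ^ 2 * (D / L) + (1 + ‖p‖ ^ 2) ^ 2) / (2 * ‖s‖ ^ 2 * (L * L)) := by
        gcongr
    _ = _ := by field_simp; ring

theorem eigenvalue_asymptotics (a b : ℂ) (t : ℝ) (ht : t ∈ Set.Ioo (0:ℝ) Real.pi)
    (lam : ℕ → ℂ)
    (h : ∃ N : ℕ, ∀ n : ℕ, N ≤ n →
      IsEigenvalueH a b t (lam n) ∧
        ‖lam n - (((2 * Real.pi * n + t : ℝ) : ℂ))^2‖ ≤ 1) :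
    ∃ C : ℝ, 0 < C ∧ ∃ N : ℕ, ∀ n : ℕ, N ≤ n →
      ‖lam n - (((2 * Real.pi * n + t : ℝ) : ℂ))^2 -
          a * b / (2 * (((2 * Real.pi * n + t : ℝ) : ℂ))^2)‖
        ≤ C / (n : ℝ)^3 := by
  obtain ⟨N, hN⟩ := h
  obtain ⟨κ, hκ, hgap⟩ := exists_quasimomentum_gap ht
  set Q := ‖a‖ + ‖b‖ with hQ
  have hQ0 : 0 ≤ Q := by positivity
  set P := ‖(2 * Real.pi : ℂ)‖ with hP
  refine ⟨8 * Q ^ 4 / κ ^ 3 +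
    ‖a * b‖ * (16 * Q ^ 2 / κ ^ 3 + 2 * (1 + P ^ 2) ^ 2 / κ ^ 2) + 1, by positivity,
    max N (max 1 ⌈(2 + 4 * Q) / κ⌉₊), fun n hn => ?_⟩
  obtain ⟨⟨y, hy, hne, hode, h0, h1⟩, hlam⟩ := hN n (le_of_max_le_left hn)
  have hn1 : (1:ℝ) ≤ n := by
    exact_mod_cast (le_max_left _ _).trans (le_of_max_le_right hn)
  have hnκ : 2 + 4 * Q ≤ κ * n := by
    have h2 : ((2 + 4 * Q) / κ) ≤ n :=
      Nat.ceil_le.mp ((le_max_right _ _).trans (le_of_max_le_right hn))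
    rw [div_le_iff₀ hκ] at h2
    linarith
  set s : ℂ := ((2 * Real.pi * n + t : ℝ) : ℂ) with hs
  set L : ℝ := κ * n / 2 with hL
  have hL0 : 0 < L := by positivity
  set μ : ℤ → ℂ := fun k => (2 * Real.pi * k + t) ^ 2 with hμ
  have hμn : μ n = s ^ 2 := by simp [hμ, hs]
  have hgap' : ∀ k : ℤ, k ≠ n → L ≤ ‖lam n - μ k‖ := fun k hk => by
    have h2 : ‖s ^ 2 - μ k‖ = |(2 * Real.pi * n + t) ^ 2 - (2 * Real.pi * k + t) ^ 2| := by
      rw [← Real.norm_eq_abs, ← Complex.norm_real]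
      simp [hs, hμ]
    have h3 := hgap n k hk
    have h4 : ‖s ^ 2 - μ k‖ ≤ ‖lam n - μ k‖ + ‖lam n - s ^ 2‖ := by
      have h5 := norm_sub_le (lam n - μ k) (lam n - s ^ 2)
      rwa [sub_sub_sub_cancel_left] at h5
    linarith
  obtain ⟨hδ, hest⟩ := eigenvalue_estimate_of_recurrence (μ := μ) hL0 (by linarith)
    (quasiFourierCoeff_recurrence hy hode h0 h1) hgap'
    (bddAbove_norm_quasiFourierCoeff t hy.continuous)
    (exists_quasiFourierCoeff_ne_zero hy.continuous h0 hne)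
  have hs1 : (n:ℝ) ≤ ‖s‖ := by
    rw [hs, Complex.norm_real]
    refine le_trans ?_ (le_abs_self _)
    nlinarith [Real.pi_gt_three, ht.1]
  have hs0 : s ≠ 0 := norm_pos_iff.mp (by linarith)
  have hp : μ (n + 1) = (s + 2 * Real.pi) ^ 2 := by
    simp only [hμ, hs]; push_cast; ring
  have hm : μ (n - 1) = (s - 2 * Real.pi) ^ 2 := by
    simp only [hμ, hs]; push_cast; ring
  have hgp := hgap' (n + 1) (by omega)
  have hgm := hgap' (n - 1) (by omega)
  rw [hμn, hp, hm] at hest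
  rw [hμn] at hδ
  rw [hp] at hgp
  rw [hm] at hgm
  have hres := norm_resolvent_sum_sub_le (s := s) (δ := lam n - s ^ 2) (p := 2 * Real.pi)
    hL0 hs0 hlam hδ (by rwa [add_sub_cancel]) (by rwa [add_sub_cancel])
  rw [add_sub_cancel] at hres
  set S := 1 / (lam n - (s + 2 * Real.pi) ^ 2) + 1 / (lam n - (s - 2 * Real.pi) ^ 2) with hS
  have hn0 : (0:ℝ) < n := by linarith
  calc ‖lam n - s ^ 2 - a * b / (2 * s ^ 2)‖
      = ‖(lam n - s ^ 2 - a * b * S) + a * b * (S - 1 / (2 * s ^ 2))‖ := by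
        congr 1; ring
    _ ≤ Q ^ 4 / L ^ 3 + ‖a * b‖ *
          (2 * Q ^ 2 / L ^ 3 + (1 + P ^ 2) ^ 2 / (2 * ‖s‖ ^ 2 * L ^ 2)) := by
        refine (norm_add_le _ _).trans ?_
        rw [norm_mul (a * b)]
        gcongr
    _ ≤ Q ^ 4 / L ^ 3 + ‖a * b‖ *
          (2 * Q ^ 2 / L ^ 3 + (1 + P ^ 2) ^ 2 / (2 * n * L ^ 2)) := by
        gcongr
        nlinarith
    _ = (8 * Q ^ 4 / κ ^ 3 +
          ‖a * b‖ * (16 * Q ^ 2 / κ ^ 3 + 2 * (1 + P ^ 2) ^ 2 / κ ^ 2)) / (n:ℝ) ^ 3 := by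
        rw [hL]
        field_simp
        ring
    _ ≤ _ := div_le_div_of_nonneg_right (le_add_of_nonneg_right zero_le_one) (by positivity)
end
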